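/- Let X(·,t), t ∈ [0, +∞), be a smooth solution of Gage's area-preserving flow with smooth embedded closed initial curve, with curvature κ(·,t) and length L(t). Then the L² norm over the evolving curve of the arc-length derivative of the curvature converges to zero as t → ∞: lim_{t→∞} ∫₀^{L(t)} (∂κ/∂s)² ds = 0. -/

import Mathlib

open Real Set MeasureTheory Filter

noncomputable section

/-- Euclidean norm of a plane vector. -/
def vnorm (v : ℝ × ℝ) : ℝ := Real.sqrt (v.1 ^ 2 + v.2 ^ 2)

/-- Determinant of the 2×2 matrix whose rows are the plane vectors `a`, `b`. -/
def vdet (a b : ℝ × ℝ) : ℝ := a.1 * b.2 - a.2 * b.1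

/-- Unit tangent vector of a plane curve. -/
def unitTangent (X : ℝ → ℝ × ℝ) (φ : ℝ) : ℝ × ℝ :=
  (vnorm (deriv X φ))⁻¹ • deriv X φ

/-- Inward unit normal: the rotation of the unit tangent by +π/2. -/
def innerNormal (X : ℝ → ℝ × ℝ) (φ : ℝ) : ℝ × ℝ :=
  (-(unitTangent X φ).2, (unitTangent X φ).1)

/-- Curvature of a plane curve. -/
def curv (X : ℝ → ℝ × ℝ) (φ : ℝ) : ℝ :=
  vdet (deriv X φ) (deriv (deriv X) φ) / vnorm (deriv X φ) ^ 3

/-- Length of a closed plane curve parametrized on `[0, 2π]`. -/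
def clen (X : ℝ → ℝ × ℝ) : ℝ := ∫ φ in (0:ℝ)..(2 * π), vnorm (deriv X φ)

/-- Enclosed area of a closed plane curve. -/
def carea (X : ℝ → ℝ × ℝ) : ℝ :=
  (1 / 2) * ∫ φ in (0:ℝ)..(2 * π), vdet (X φ) (deriv X φ)

/-- A smooth closed plane curve: a smooth `2π`-periodic map `ℝ → ℝ²` with
nonvanishing derivative. -/
structure IsSmoothClosedCurve (X : ℝ → ℝ × ℝ) : Prop where
  smooth : ContDiff ℝ (⊤ : ℕ∞) X
  periodic : Function.Periodic X (2 * π)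
  regular : ∀ φ, deriv X φ ≠ 0

/-- An embedded closed curve: injective over one period. -/
def IsEmbeddedCurve (X : ℝ → ℝ × ℝ) : Prop := Set.InjOn X (Set.Ico 0 (2 * π))

/-- Star-shapedness with respect to a point `O`: `det(X − O, T) > 0` everywhere. -/
def StarShapedWrt (X : ℝ → ℝ × ℝ) (O : ℝ × ℝ) : Prop :=
  ∀ φ, 0 < vdet (X φ - O) (unitTangent X φ)

/-- Centrosymmetry with respect to a point `O`: the image of the curve is invariant
under the point reflection `Z ↦ 2O − Z`. -/
def CentroSymmetricWrt (X : ℝ → ℝ × ℝ) (O : ℝ × ℝ) : Prop :=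
  (fun Z => (2 : ℝ) • O - Z) '' Set.range X = Set.range X

/-- `X` is a smooth solution of Gage's area-preserving flow on the time set `I`
with initial curve `X₀`: `∂X/∂t = α T + (κ − 2π/L) N`. -/
structure IsGAPFSolutionOn (X : ℝ → ℝ → ℝ × ℝ) (X₀ : ℝ → ℝ × ℝ) (I : Set ℝ) : Prop where
  init : ∀ φ, X 0 φ = X₀ φ
  curve : ∀ t ∈ I, IsSmoothClosedCurve (X t)
  smooth : ContDiffOn ℝ (⊤ : ℕ∞) (fun p : ℝ × ℝ => X p.1 p.2) (I ×ˢ Set.univ)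
  flow : ∃ α : ℝ → ℝ → ℝ,
    ∀ t ∈ I, ∀ φ,
      HasDerivWithinAt (fun τ => X τ φ)
        (α t φ • unitTangent (X t) φ +
          (curv (X t) φ - 2 * π / clen (X t)) • innerNormal (X t) φ) I t

/-- The arc-length integral `∫₀^L (∂κ/∂s)² ds` over the evolving curve, written in the
parameter `φ` (with `∂κ/∂s = (∂κ/∂φ)/|∂X/∂φ|` and `ds = |∂X/∂φ| dφ`). -/
def gapfCurvDerivIntegral (X : ℝ → ℝ → ℝ × ℝ) (t : ℝ) : ℝ :=
  ∫ φ in (0:ℝ)..(2 * π),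
    (deriv (curv (X t)) φ / vnorm (deriv (X t) φ)) ^ 2 * vnorm (deriv (X t) φ)

def dP (g : ℝ → ℝ → ℝ) : ℝ → ℝ → ℝ := fun t φ => deriv (g t) φ
def dT (g : ℝ → ℝ → ℝ) : ℝ → ℝ → ℝ := fun t φ => deriv (fun τ => g τ φ) t

def UU : Set (ℝ × ℝ) := Ioi 0 ×ˢ univ

theorem UU_open : IsOpen UU := isOpen_Ioi.prod isOpen_univ

theorem mem_UU {t φ : ℝ} (ht : 0 < t) : (t, φ) ∈ UU := ⟨ht, mem_univ _⟩

/-- Smooth on positive times and periodic in the space variable. -/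
structure SP (g : ℝ → ℝ → ℝ) : Prop where
  sm : ContDiffOn ℝ (⊤ : ℕ∞) (fun p : ℝ × ℝ => g p.1 p.2) UU
  per : ∀ t, 0 < t → ∀ φ, g t (φ + 2 * π) = g t φ

namespace SP

theorem add {g h : ℝ → ℝ → ℝ} (hg : SP g) (hh : SP h) : SP (fun t φ => g t φ + h t φ) :=
  ⟨hg.sm.add hh.sm, fun t ht φ => by simp [hg.per t ht, hh.per t ht]⟩

theorem sub {g h : ℝ → ℝ → ℝ} (hg : SP g) (hh : SP h) : SP (fun t φ => g t φ - h t φ) :=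
  ⟨hg.sm.sub hh.sm, fun t ht φ => by simp [hg.per t ht, hh.per t ht]⟩

theorem mul {g h : ℝ → ℝ → ℝ} (hg : SP g) (hh : SP h) : SP (fun t φ => g t φ * h t φ) :=
  ⟨hg.sm.mul hh.sm, fun t ht φ => by simp [hg.per t ht, hh.per t ht]⟩

theorem neg {g : ℝ → ℝ → ℝ} (hg : SP g) : SP (fun t φ => - g t φ) :=
  ⟨hg.sm.neg, fun t ht φ => by simp [hg.per t ht]⟩

theorem const (c : ℝ) : SP (fun _ _ => c) :=
  ⟨contDiffOn_const, fun _ _ _ => rfl⟩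

theorem pow {g : ℝ → ℝ → ℝ} (hg : SP g) (n : ℕ) : SP (fun t φ => g t φ ^ n) :=
  ⟨hg.sm.pow n, fun t ht φ => by simp [hg.per t ht]⟩

theorem div {g h : ℝ → ℝ → ℝ} (hg : SP g) (hh : SP h) (h0 : ∀ t, 0 < t → ∀ φ, h t φ ≠ 0) :
    SP (fun t φ => g t φ / h t φ) :=
  ⟨hg.sm.div hh.sm (fun p hp => h0 p.1 hp.1 p.2), fun t ht φ => by
    simp [hg.per t ht, hh.per t ht]⟩

theorem sqrt {g : ℝ → ℝ → ℝ} (hg : SP g) (h0 : ∀ t, 0 < t → ∀ φ, g t φ ≠ 0) :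
    SP (fun t φ => Real.sqrt (g t φ)) :=
  ⟨hg.sm.sqrt (fun p hp => h0 p.1 hp.1 p.2), fun t ht φ => by simp [hg.per t ht]⟩

theorem fd {g : ℝ → ℝ → ℝ} (hg : SP g) {t φ : ℝ} (ht : 0 < t) :
    HasFDerivAt (fun p : ℝ × ℝ => g p.1 p.2)
      (fderiv ℝ (fun p : ℝ × ℝ => g p.1 p.2) (t, φ)) (t, φ) :=
  ((hg.sm.contDiffAt (UU_open.mem_nhds (mem_UU ht))).differentiableAt (by simp)).hasFDerivAt

theorem hasP' {g : ℝ → ℝ → ℝ} (hg : SP g) {t : ℝ} (ht : 0 < t) (φ : ℝ) :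
    HasDerivAt (g t) (fderiv ℝ (fun p : ℝ × ℝ => g p.1 p.2) (t, φ) (0, 1)) φ := by
  have h2 : HasDerivAt (fun φ : ℝ => ((t, φ) : ℝ × ℝ)) ((0 : ℝ), (1 : ℝ)) φ :=
    (hasDerivAt_const φ t).prodMk (hasDerivAt_id φ)
  exact (hg.fd ht).comp_hasDerivAt φ h2

theorem hasT' {g : ℝ → ℝ → ℝ} (hg : SP g) {t : ℝ} (ht : 0 < t) (φ : ℝ) :
    HasDerivAt (fun τ => g τ φ) (fderiv ℝ (fun p : ℝ × ℝ => g p.1 p.2) (t, φ) (1, 0)) t := by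
  have h2 : HasDerivAt (fun τ : ℝ => ((τ, φ) : ℝ × ℝ)) ((1 : ℝ), (0 : ℝ)) t :=
    (hasDerivAt_id t).prodMk (hasDerivAt_const t φ)
  exact (hg.fd (φ := φ) ht).comp_hasDerivAt t h2

theorem dP_eq' {g : ℝ → ℝ → ℝ} (hg : SP g) {t : ℝ} (ht : 0 < t) (φ : ℝ) :
    dP g t φ = fderiv ℝ (fun p : ℝ × ℝ => g p.1 p.2) (t, φ) (0, 1) := (hg.hasP' ht φ).deriv

theorem dT_eq' {g : ℝ → ℝ → ℝ} (hg : SP g) {t : ℝ} (ht : 0 < t) (φ : ℝ) :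
    dT g t φ = fderiv ℝ (fun p : ℝ × ℝ => g p.1 p.2) (t, φ) (1, 0) := (hg.hasT' ht φ).deriv

theorem hasP {g : ℝ → ℝ → ℝ} (hg : SP g) {t : ℝ} (ht : 0 < t) (φ : ℝ) :
    HasDerivAt (g t) (dP g t φ) φ := by
  rw [hg.dP_eq' ht]; exact hg.hasP' ht φ

theorem hasT {g : ℝ → ℝ → ℝ} (hg : SP g) {t : ℝ} (ht : 0 < t) (φ : ℝ) :
    HasDerivAt (fun τ => g τ φ) (dT g t φ) t := by
  rw [hg.dT_eq' ht]; exact hg.hasT' ht φ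

theorem fdsm {g : ℝ → ℝ → ℝ} (hg : SP g) :
    ContDiffOn ℝ (⊤ : ℕ∞) (fderiv ℝ (fun p : ℝ × ℝ => g p.1 p.2)) UU :=
  hg.sm.fderiv_of_isOpen UU_open (by simp)

theorem dp {g : ℝ → ℝ → ℝ} (hg : SP g) : SP (dP g) where
  sm := by
    refine (hg.fdsm.clm_apply (contDiffOn_const (c := ((0 : ℝ), (1 : ℝ))))).congr ?_
    rintro ⟨t, φ⟩ hp
    exact hg.dP_eq' hp.1 φ
  per := by
    intro t ht φ
    have h : HasDerivAt (fun x => g t (x + 2 * π)) (dP g t (φ + 2 * π)) φ :=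
      (hg.hasP ht (φ + 2 * π)).comp_add_const φ (2 * π)
    have h2 : (fun x => g t (x + 2 * π)) = g t := funext (hg.per t ht)
    rw [h2] at h
    exact h.unique (hg.hasP ht φ)

theorem dt {g : ℝ → ℝ → ℝ} (hg : SP g) : SP (dT g) where
  sm := by
    refine (hg.fdsm.clm_apply (contDiffOn_const (c := ((1 : ℝ), (0 : ℝ))))).congr ?_
    rintro ⟨t, φ⟩ hp
    exact hg.dT_eq' hp.1 φ
  per := by
    intro t ht φ
    have h := hg.hasT ht (φ + 2 * π)
    have h2 := hg.hasT ht φ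
    refine (h.congr_of_eventuallyEq ?_).unique h2
    filter_upwards [Ioi_mem_nhds ht] with τ hτ
    exact (hg.per τ hτ φ).symm

theorem comm {g : ℝ → ℝ → ℝ} (hg : SP g) {t : ℝ} (ht : 0 < t) (φ : ℝ) :
    dT (dP g) t φ = dP (dT g) t φ := by
  set G := (fun p : ℝ × ℝ => g p.1 p.2) with hG
  have hd : HasFDerivAt (fderiv ℝ G) (fderiv ℝ (fderiv ℝ G) (t, φ)) (t, φ) :=
    ((hg.fdsm.contDiffAt (UU_open.mem_nhds (mem_UU ht))).differentiableAt (by simp)).hasFDerivAt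
  have hsym : IsSymmSndFDerivAt ℝ G (t, φ) :=
    (hg.sm.contDiffAt (UU_open.mem_nhds (mem_UU ht))).isSymmSndFDerivAt (by
      simp; exact WithTop.coe_le_coe.2 (le_top : (2 : ℕ∞) ≤ ⊤))
  have e1 : HasDerivAt (fun τ => fderiv ℝ G (τ, φ) (0, 1))
      (fderiv ℝ (fderiv ℝ G) (t, φ) (1, 0) (0, 1)) t := by
    have h2 : HasDerivAt (fun τ : ℝ => ((τ, φ) : ℝ × ℝ)) ((1 : ℝ), (0 : ℝ)) t :=
      (hasDerivAt_id t).prodMk (hasDerivAt_const t φ)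
    have h3 := hd.comp_hasDerivAt t h2
    have h4 := h3.clm_apply (hasDerivAt_const t ((0 : ℝ), (1 : ℝ)))
    simpa using h4
  have e2 : HasDerivAt (fun x => fderiv ℝ G (t, x) (1, 0))
      (fderiv ℝ (fderiv ℝ G) (t, φ) (0, 1) (1, 0)) φ := by
    have h2 : HasDerivAt (fun x : ℝ => ((t, x) : ℝ × ℝ)) ((0 : ℝ), (1 : ℝ)) φ :=
      (hasDerivAt_const φ t).prodMk (hasDerivAt_id φ)
    have h3 := hd.comp_hasDerivAt φ h2
    have h4 := h3.clm_apply (hasDerivAt_const φ ((1 : ℝ), (0 : ℝ)))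
    simpa using h4
  have f1 : dT (dP g) t φ = fderiv ℝ (fderiv ℝ G) (t, φ) (1, 0) (0, 1) := by
    refine (e1.congr_of_eventuallyEq ?_).deriv
    filter_upwards [Ioi_mem_nhds ht] with τ hτ
    exact hg.dP_eq' hτ φ
  have f2 : dP (dT g) t φ = fderiv ℝ (fderiv ℝ G) (t, φ) (0, 1) (1, 0) := by
    refine (e2.congr_of_eventuallyEq ?_).deriv
    filter_upwards with x
    exact hg.dT_eq' ht x
  rw [f1, f2]
  exact hsym _ _

theorem cont {g : ℝ → ℝ → ℝ} (hg : SP g) {t : ℝ} (ht : 0 < t) : Continuous (g t) :=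
  continuous_iff_continuousAt.2 fun φ => (hg.hasP ht φ).continuousAt

theorem ii {g : ℝ → ℝ → ℝ} (hg : SP g) {t : ℝ} (ht : 0 < t) (a b : ℝ) :
    IntervalIntegrable (g t) volume a b := (hg.cont ht).intervalIntegrable a b

theorem int_dP {g : ℝ → ℝ → ℝ} (hg : SP g) {t : ℝ} (ht : 0 < t) :
    ∫ φ in (0:ℝ)..(2 * π), dP g t φ = 0 := by
  rw [intervalIntegral.integral_eq_sub_of_hasDerivAt (f := g t)
    (fun x _ => hg.hasP ht x) (hg.dp.ii ht _ _)]
  have := hg.per t ht 0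
  simp only [zero_add] at this
  rw [this, sub_self]

theorem int_hasDeriv {g : ℝ → ℝ → ℝ} (hg : SP g) {t : ℝ} (ht : 0 < t) :
    HasDerivAt (fun τ => ∫ φ in (0:ℝ)..(2 * π), g τ φ)
      (∫ φ in (0:ℝ)..(2 * π), dT g t φ) t := by
  have hK : IsCompact ((Icc (t/2) (2*t)) ×ˢ (Icc (0:ℝ) (2 * π))) := isCompact_Icc.prod isCompact_Icc
  have hc : ContinuousOn (fun p : ℝ × ℝ => dT g p.1 p.2)
      ((Icc (t/2) (2*t)) ×ˢ (Icc (0:ℝ) (2 * π))) :=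
    hg.dt.sm.continuousOn.mono (fun p hp => ⟨lt_of_lt_of_le (by linarith) hp.1.1, mem_univ _⟩)
  obtain ⟨C, hC⟩ := hK.exists_bound_of_continuousOn hc
  have hpi : (0:ℝ) ≤ 2 * π := by positivity
  refine (intervalIntegral.hasDerivAt_integral_of_dominated_loc_of_deriv_le
    (F := g) (F' := dT g) (s := Icc (t/2) (2*t)) (bound := fun _ => C)
    (Icc_mem_nhds (by linarith) (by linarith)) ?_ (hg.ii ht _ _) ?_ ?_ ?_ ?_).2
  · filter_upwards [Ioi_mem_nhds ht] with τ hτ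
    exact (hg.cont hτ).aestronglyMeasurable
  · exact (hg.dt.cont ht).aestronglyMeasurable
  · refine ae_of_all _ fun φ hφ τ hτ => ?_
    rw [uIoc_of_le hpi] at hφ
    exact hC (τ, φ) ⟨hτ, hφ.1.le, hφ.2⟩
  · exact intervalIntegrable_const
  · refine ae_of_all _ fun φ _ τ hτ => hg.hasT (lt_of_lt_of_le (by linarith) hτ.1) φ

theorem dT_eq {g h : ℝ → ℝ → ℝ} {t φ d : ℝ} (ht : 0 < t)
    (hd : HasDerivAt (fun τ => h τ φ) d t) (hgh : ∀ τ, 0 < τ → g τ φ = h τ φ) :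
    dT g t φ = d := by
  refine (hd.congr_of_eventuallyEq ?_).deriv
  filter_upwards [Ioi_mem_nhds ht] with τ hτ
  exact hgh τ hτ

theorem dP_eq {g h : ℝ → ℝ → ℝ} {t φ d : ℝ}
    (hd : HasDerivAt (h t) d φ) (hgh : ∀ x, g t x = h t x) :
    dP g t φ = d := by
  have : g t = h t := funext hgh
  unfold dP
  rw [this]; exact hd.deriv

end SP

theorem anti_of_deriv {P P' : ℝ → ℝ} {a : ℝ} (h : ∀ t, a ≤ t → HasDerivAt P (P' t) t)
    (h0 : ∀ t, a ≤ t → P' t ≤ 0) : AntitoneOn P (Ici a) := by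
  refine antitoneOn_of_deriv_nonpos (convex_Ici a)
    (fun t ht => (h t ht).continuousAt.continuousWithinAt) ?_ ?_
  · intro t ht
    rw [interior_Ici] at ht
    exact (h t ht.le).differentiableAt.differentiableWithinAt
  · intro t ht
    rw [interior_Ici] at ht
    rw [(h t ht.le).deriv]; exact h0 t ht.le

/-- A function bounded below cannot decrease at a definite rate for ever. -/
theorem no_linear_decay {P P' : ℝ → ℝ} {a c : ℝ} (hc : 0 < c)
    (h : ∀ t, a ≤ t → HasDerivAt P (P' t) t)
    (hP : ∀ t, a ≤ t → 0 ≤ P t) (h0 : ∀ t, a ≤ t → P' t ≤ -c) : False := by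
  have hanti : AntitoneOn (fun t => P t + c * t) (Ici a) :=
    anti_of_deriv (P' := fun t => P' t + c)
      (fun t ht => by simpa using (h t ht).fun_add ((hasDerivAt_id t).const_mul c))
      (fun t ht => by linarith [h0 t ht])
  have hPa := hP a le_rfl
  have hb : a ≤ a + (P a + 1) / c := by
    have : 0 ≤ (P a + 1) / c := by positivity
    linarith
  have h1 := hanti (mem_Ici.2 le_rfl) (mem_Ici.2 hb) hb
  have h2 := hP _ hb
  simp only [mul_add, mul_div_cancel₀ _ hc.ne'] at h1
  linarith

theorem conv_of_anti {H : ℝ → ℝ} {a m : ℝ} (h : AntitoneOn H (Ici a))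
    (hm : ∀ t, a ≤ t → m ≤ H t) : ∃ l, Tendsto H atTop (nhds l) := by
  have hanti : Antitone (fun t => H (max a t)) := fun s t hst =>
    h (mem_Ici.2 (le_max_left _ _)) (mem_Ici.2 (le_max_left _ _)) (max_le_max le_rfl hst)
  have := tendsto_atTop_ciInf hanti ⟨m, by
    rintro _ ⟨t, rfl⟩
    exact hm _ (le_max_left _ _)⟩
  refine ⟨_, this.congr' ?_⟩
  filter_upwards [eventually_ge_atTop a] with t ht
  rw [max_eq_right ht]

theorem decay_lemma {G G' P P' : ℝ → ℝ} {a C : ℝ} (hC : 0 ≤ C)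
    (hG : ∀ t, a ≤ t → HasDerivAt G (G' t) t) (hP : ∀ t, a ≤ t → HasDerivAt P (P' t) t)
    (hG0 : ∀ t, a ≤ t → 0 ≤ G t) (hP0 : ∀ t, a ≤ t → 0 ≤ P t)
    (hPG : ∀ t, a ≤ t → P' t ≤ - G t)
    (hGG : ∀ t, a ≤ t → G' t ≤ C * (G t + G t ^ 3)) :
    Tendsto G atTop (nhds 0) := by
  have hPl := conv_of_anti (anti_of_deriv hP fun t ht => by linarith [hPG t ht, hG0 t ht]) hP0
  obtain ⟨l1, hl1⟩ := hPl
  have hH := conv_of_anti (H := fun t => arctan (G t) + C * P t) (a := a) (m := 0)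
    (anti_of_deriv (P' := fun t => 1 / (1 + G t ^ 2) * G' t + C * P' t)
      (fun t ht => ((hG t ht).arctan).add ((hP t ht).const_mul C)) (fun t ht => by
        have h1 : 1 / (1 + G t ^ 2) * G' t ≤ C * G t := by
          rw [one_div, inv_mul_le_iff₀ (by positivity)]
          calc G' t ≤ _ := hGG t ht
            _ = _ := by ring
        nlinarith [hPG t ht]))
    (fun t ht => by
      have := arctan_nonneg.2 (hG0 t ht)
      have := mul_nonneg hC (hP0 t ht)
      linarith)
  obtain ⟨l2, hl2⟩ := hH
  have hA : Tendsto (fun t => arctan (G t)) atTop (nhds (l2 - C * l1)) := by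
    refine (hl2.sub (hl1.const_mul C)).congr fun t => by ring
  set l := l2 - C * l1
  have hl0 : 0 ≤ l := ge_of_tendsto hA (by
    filter_upwards [eventually_ge_atTop a] with t ht
    exact arctan_nonneg.2 (hG0 t ht))
  have hl : l = 0 := by
    by_contra hne
    have hpos : 0 < l := lt_of_le_of_ne hl0 (Ne.symm hne)
    obtain ⟨b, hb⟩ := eventually_atTop.1
      ((hA.eventually (lt_mem_nhds (show l / 2 < l by linarith))).and (eventually_ge_atTop a))
    have hab : a ≤ b := (hb b le_rfl).2
    refine no_linear_decay (c := l / 2) (a := b) (by linarith)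
      (fun t ht => hP t (hab.trans ht)) (fun t ht => hP0 t (hab.trans ht)) (fun t ht => ?_)
    have h1 := (hb t ht).1
    have h2 := le_tan (arctan_nonneg.2 (hG0 t (hab.trans ht))) (arctan_lt_pi_div_two _)
    rw [tan_arctan] at h2
    linarith [hPG t (hab.trans ht)]
  rw [hl] at hA
  have h3 := (continuousAt_tan.2 (by simp : cos 0 ≠ 0)).tendsto.comp hA
  simpa [Function.comp_def, tan_arctan] using h3

/-- Integral over one period. -/
def II (g : ℝ → ℝ → ℝ) (t : ℝ) : ℝ := ∫ φ in (0:ℝ)..(2 * π), g t φ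

theorem SP.II_hasDeriv {g h w : ℝ → ℝ → ℝ} (hg : SP g) (hh : SP h) (hw : SP w) {t : ℝ}
    (ht : 0 < t) (e : ∀ φ, dT g t φ = h t φ + dP w t φ) :
    HasDerivAt (II g) (II h t) t := by
  have h1 := hg.int_hasDeriv ht
  have h2 : ∫ φ in (0:ℝ)..(2 * π), dT g t φ = II h t := by
    simp only [e]
    rw [intervalIntegral.integral_add (hh.ii ht _ _) (hw.dp.ii ht _ _), hw.int_dP ht, add_zero]
    rfl
  rw [h2] at h1
  exact h1

theorem SP.II_hasDeriv2 {g h w : ℝ → ℝ → ℝ} (hg : SP g) (hh : SP h) (hw : SP w) {t : ℝ}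
    {d e : ℝ → ℝ} (ht : 0 < t) (hd : ∀ φ, HasDerivAt (fun τ => g τ φ) (d φ) t)
    (he : ∀ φ, HasDerivAt (w t) (e φ) φ) (E : ∀ φ, d φ = h t φ + e φ) :
    HasDerivAt (II g) (II h t) t :=
  hg.II_hasDeriv hh hw ht fun φ => by
    rw [(hg.hasT ht φ).unique (hd φ), (hw.hasP ht φ).unique (he φ), E]

/-- The analytic data of a solution of the flow: position `(x, y)`, unit tangent `(p, q)`, speed
`v`, curvature `k` and its first two arc length derivatives `k1`, `k2`, tangential speed `a`,
normal speed `f`. -/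
structure GFlow (x y p q v k k1 k2 a f : ℝ → ℝ → ℝ) : Prop where
  sx : SP x
  sy : SP y
  sp : SP p
  sq : SP q
  sv : SP v
  sk : SP k
  sk1 : SP k1
  sk2 : SP k2
  sa : SP a
  sf : SP f
  vpos : ∀ t, 0 < t → ∀ φ, 0 < v t φ
  xp : ∀ t, 0 < t → ∀ φ, dP x t φ = v t φ * p t φ
  yp : ∀ t, 0 < t → ∀ φ, dP y t φ = v t φ * q t φ
  unit : ∀ t, 0 < t → ∀ φ, p t φ ^ 2 + q t φ ^ 2 = 1
  pp : ∀ t, 0 < t → ∀ φ, dP p t φ = - (k t φ * v t φ * q t φ)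
  qp : ∀ t, 0 < t → ∀ φ, dP q t φ = k t φ * v t φ * p t φ
  kp : ∀ t, 0 < t → ∀ φ, dP k t φ = k1 t φ * v t φ
  k1p : ∀ t, 0 < t → ∀ φ, dP k1 t φ = k2 t φ * v t φ
  xt : ∀ t, 0 < t → ∀ φ, dT x t φ = a t φ * p t φ - f t φ * q t φ
  yt : ∀ t, 0 < t → ∀ φ, dT y t φ = a t φ * q t φ + f t φ * p t φ
  feq : ∀ t, 0 < t → ∀ φ, f t φ = k t φ - 2 * π / II v t

namespace GFlow

variable {x y p q v k k1 k2 a f : ℝ → ℝ → ℝ}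

theorem fp (H : GFlow x y p q v k k1 k2 a f) {t : ℝ} (ht : 0 < t) (φ : ℝ) :
    dP f t φ = k1 t φ * v t φ := by
  rw [← H.kp t ht]
  exact SP.dP_eq (h := fun t φ => k t φ - 2 * π / II v t) ((H.sk.hasP ht φ).sub_const _) (H.feq t ht)

theorem aux (H : GFlow x y p q v k k1 k2 a f) {t : ℝ} (ht : 0 < t) (φ : ℝ) :
    dT v t φ = dP a t φ - f t φ * k t φ * v t φ ∧
    dT p t φ = - ((a t φ * k t φ + k1 t φ) * q t φ) ∧
    dT q t φ = (a t φ * k t φ + k1 t φ) * p t φ := by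
  have c1 := H.sx.comm ht φ
  have c2 := H.sy.comm ht φ
  have d1 : dT (dP x) t φ = dT v t φ * p t φ + v t φ * dT p t φ :=
    SP.dT_eq (h := fun t φ => v t φ * p t φ) ht ((H.sv.hasT ht φ).fun_mul (H.sp.hasT ht φ))
      (fun τ hτ => H.xp τ hτ φ)
  have d2 : dT (dP y) t φ = dT v t φ * q t φ + v t φ * dT q t φ :=
    SP.dT_eq (h := fun t φ => v t φ * q t φ) ht ((H.sv.hasT ht φ).fun_mul (H.sq.hasT ht φ))
      (fun τ hτ => H.yp τ hτ φ)
  have d3 : dP (dT x) t φ = (dP a t φ * p t φ + a t φ * dP p t φ)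
      - (dP f t φ * q t φ + f t φ * dP q t φ) :=
    SP.dP_eq (h := fun t φ => a t φ * p t φ - f t φ * q t φ)
      (((H.sa.hasP ht φ).fun_mul (H.sp.hasP ht φ)).fun_sub
        ((H.sf.hasP ht φ).fun_mul (H.sq.hasP ht φ))) (H.xt t ht)
  have d4 : dP (dT y) t φ = (dP a t φ * q t φ + a t φ * dP q t φ)
      + (dP f t φ * p t φ + f t φ * dP p t φ) :=
    SP.dP_eq (h := fun t φ => a t φ * q t φ + f t φ * p t φ)
      (((H.sa.hasP ht φ).fun_mul (H.sq.hasP ht φ)).fun_add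
        ((H.sf.hasP ht φ).fun_mul (H.sp.hasP ht φ))) (H.yt t ht)
  have d5 : 2 * p t φ * dT p t φ + 2 * q t φ * dT q t φ = 0 := by
    have h1 := ((H.sp.hasT ht φ).fun_pow 2).fun_add ((H.sq.hasT ht φ).fun_pow 2)
    have h2 := SP.dT_eq (g := fun _ _ => (1:ℝ)) (h := fun t φ => p t φ ^ 2 + q t φ ^ 2) ht h1
      (fun τ hτ => (H.unit τ hτ φ).symm)
    have h3 : dT (fun _ _ => (1:ℝ)) t φ = 0 := by simp [dT]
    rw [h3] at h2
    simp at h2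
    linarith
  rw [d1, d3, H.fp ht, H.pp t ht, H.qp t ht] at c1
  rw [d2, d4, H.fp ht, H.pp t ht, H.qp t ht] at c2
  have u := H.unit t ht φ
  have hv := (H.vpos t ht φ)
  have hvt : dT v t φ = dP a t φ - f t φ * k t φ * v t φ := by
    linear_combination (p t φ) * c1 + (q t φ) * c2 - v t φ / 2 * d5
      + (- dT v t φ + dP a t φ - f t φ * k t φ * v t φ) * u
  rw [hvt] at c1 c2
  refine ⟨hvt, ?_, ?_⟩
  · apply mul_left_cancel₀ hv.ne'
    linear_combination c1
  · apply mul_left_cancel₀ hv.ne'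
    linear_combination c2

theorem vt (H : GFlow x y p q v k k1 k2 a f) {t : ℝ} (ht : 0 < t) (φ : ℝ) :
    dT v t φ = dP a t φ - f t φ * k t φ * v t φ := (H.aux ht φ).1
theorem pt (H : GFlow x y p q v k k1 k2 a f) {t : ℝ} (ht : 0 < t) (φ : ℝ) :
    dT p t φ = - ((a t φ * k t φ + k1 t φ) * q t φ) := (H.aux ht φ).2.1
theorem qt (H : GFlow x y p q v k k1 k2 a f) {t : ℝ} (ht : 0 < t) (φ : ℝ) :
    dT q t φ = (a t φ * k t φ + k1 t φ) * p t φ := (H.aux ht φ).2.2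

theorem kt (H : GFlow x y p q v k k1 k2 a f) {t : ℝ} (ht : 0 < t) (φ : ℝ) :
    dT k t φ = a t φ * k1 t φ + k2 t φ + f t φ * k t φ ^ 2 := by
  have c1 := H.sp.comm ht φ
  have c2 := H.sq.comm ht φ
  have kv := (H.sk.hasT ht φ).fun_mul (H.sv.hasT ht φ)
  have w := ((H.sa.hasP ht φ).fun_mul (H.sk.hasP ht φ)).fun_add (H.sk1.hasP ht φ)
  have d1 := SP.dT_eq (g := dP p) (h := fun t φ => - (k t φ * v t φ * q t φ)) ht
    ((kv.fun_mul (H.sq.hasT ht φ)).fun_neg) (fun τ hτ => H.pp τ hτ φ)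
  have d2 := SP.dT_eq (g := dP q) (h := fun t φ => (k t φ * v t φ * p t φ)) ht
    ((kv.fun_mul (H.sp.hasT ht φ))) (fun τ hτ => H.qp τ hτ φ)
  have d3 := SP.dP_eq (g := dT p) (h := fun t φ => - ((a t φ * k t φ + k1 t φ) * q t φ))
    (w.fun_mul (H.sq.hasP ht φ)).fun_neg (fun φ => H.pt ht φ)
  have d4 := SP.dP_eq (g := dT q) (h := fun t φ => (a t φ * k t φ + k1 t φ) * p t φ)
    (w.fun_mul (H.sp.hasP ht φ)) (fun φ => H.qt ht φ)
  rw [d1, d3, H.kp t ht, H.k1p t ht, H.qp t ht, H.vt ht, H.qt ht] at c1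
  rw [d2, d4, H.kp t ht, H.k1p t ht, H.pp t ht, H.vt ht, H.pt ht] at c2
  have u := H.unit t ht φ
  apply mul_left_cancel₀ (H.vpos t ht φ).ne'
  linear_combination (-q t φ) * c1 + (p t φ) * c2
     - (v t φ * (dT k t φ - (a t φ * k1 t φ + k2 t φ + f t φ * k t φ ^ 2))) * u

theorem k1t (H : GFlow x y p q v k k1 k2 a f) {t : ℝ} (ht : 0 < t) (φ : ℝ) :
    dT k1 t φ * v t φ = a t φ * k2 t φ * v t φ + dP k2 t φ + k1 t φ * v t φ * k t φ ^ 2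
      + 3 * f t φ * k t φ * k1 t φ * v t φ := by
  have c1 := H.sk.comm ht φ
  have d1 := SP.dT_eq (g := dP k) (h := fun t φ => k1 t φ * v t φ) ht
    ((H.sk1.hasT ht φ).fun_mul (H.sv.hasT ht φ)) (fun τ hτ => H.kp τ hτ φ)
  have d2 := SP.dP_eq (g := dT k) (h := fun t φ => a t φ * k1 t φ + k2 t φ + f t φ * k t φ ^ 2)
    ((((H.sa.hasP ht φ).fun_mul (H.sk1.hasP ht φ)).fun_add (H.sk2.hasP ht φ)).fun_add
      ((H.sf.hasP ht φ).fun_mul ((H.sk.hasP ht φ).fun_pow 2))) (fun φ => H.kt ht φ)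
  rw [d1, d2, H.kp t ht, H.k1p t ht, H.fp ht, H.vt ht] at c1
  simp at c1
  linear_combination c1

theorem hasL (H : GFlow x y p q v k k1 k2 a f) {t : ℝ} (ht : 0 < t) :
    HasDerivAt (II v) (II (fun t φ => - (f t φ * k t φ * v t φ)) t) t :=
  H.sv.II_hasDeriv ((H.sf.mul H.sk).mul H.sv).neg H.sa ht
    (fun φ => by rw [H.vt ht]; ring)

theorem hasK (H : GFlow x y p q v k k1 k2 a f) {t : ℝ} (ht : 0 < t) :
    HasDerivAt (II (fun t φ => k t φ * v t φ)) 0 t := by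
  have := (H.sk.mul H.sv).II_hasDeriv2 (SP.const 0) ((H.sa.mul H.sk).add H.sk1) ht
    (fun φ => (H.sk.hasT ht φ).fun_mul (H.sv.hasT ht φ))
    (fun φ => ((H.sa.hasP ht φ).fun_mul (H.sk.hasP ht φ)).fun_add (H.sk1.hasP ht φ)) (fun φ => by
    rw [H.vt ht, H.kt ht, H.kp t ht, H.k1p t ht]
    ring)
  simpa [II] using this

theorem hasA (H : GFlow x y p q v k k1 k2 a f) {t : ℝ} (ht : 0 < t) :
    HasDerivAt (II (fun t φ => x t φ * dP y t φ - y t φ * dP x t φ))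
      (II (fun t φ => -2 * (f t φ * v t φ)) t) t := by
  refine ((H.sx.mul H.sy.dp).sub (H.sy.mul H.sx.dp)).II_hasDeriv2
    ((SP.const (-2)).mul (H.sf.mul H.sv))
    ((H.sx.mul H.sy.dt).sub (H.sy.mul H.sx.dt)) ht
    (fun φ => ((H.sx.hasT ht φ).fun_mul (H.sy.dp.hasT ht φ)).fun_sub
      ((H.sy.hasT ht φ).fun_mul (H.sx.dp.hasT ht φ)))
    (fun φ => ((H.sx.hasP ht φ).fun_mul (H.sy.dt.hasP ht φ)).fun_sub
      ((H.sy.hasP ht φ).fun_mul (H.sx.dt.hasP ht φ))) (fun φ => ?_)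
  rw [H.sx.comm ht, H.sy.comm ht, H.xt t ht, H.yt t ht, H.xp t ht, H.yp t ht]
  linear_combination (-2 * f t φ * v t φ) * H.unit t ht φ

theorem hasQ (H : GFlow x y p q v k k1 k2 a f) {t : ℝ} (ht : 0 < t) :
    HasDerivAt (II (fun t φ => k t φ ^ 2 * v t φ))
      (II (fun t φ => -2 * (k1 t φ ^ 2 * v t φ) + f t φ * k t φ ^ 3 * v t φ) t) t := by
  refine ((H.sk.pow 2).mul H.sv).II_hasDeriv2
    (((SP.const (-2)).mul ((H.sk1.pow 2).mul H.sv)).add ((H.sf.mul (H.sk.pow 3)).mul H.sv))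
    ((H.sa.mul (H.sk.pow 2)).add (((SP.const 2).mul H.sk).mul H.sk1)) ht
    (fun φ => ((H.sk.hasT ht φ).fun_pow 2).fun_mul (H.sv.hasT ht φ))
    (fun φ => ((H.sa.hasP ht φ).fun_mul ((H.sk.hasP ht φ).fun_pow 2)).fun_add
      (((H.sk.hasP ht φ).const_mul 2).fun_mul (H.sk1.hasP ht φ))) (fun φ => ?_)
  rw [H.kt ht, H.vt ht, H.kp t ht, H.k1p t ht]
  simp
  ring

theorem hasD (H : GFlow x y p q v k k1 k2 a f) {t : ℝ} (ht : 0 < t) :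
    HasDerivAt (II (fun t φ => k1 t φ ^ 2 * v t φ))
      (II (fun t φ => -2 * (k2 t φ ^ 2 * v t φ) - 2 * (k2 t φ * f t φ * k t φ ^ 2 * v t φ)
        + f t φ * k t φ * k1 t φ ^ 2 * v t φ) t) t := by
  refine ((H.sk1.pow 2).mul H.sv).II_hasDeriv2
    ((((SP.const (-2)).mul ((H.sk2.pow 2).mul H.sv)).sub
      ((SP.const 2).mul (((H.sk2.mul H.sf).mul (H.sk.pow 2)).mul H.sv))).add
      (((H.sf.mul H.sk).mul (H.sk1.pow 2)).mul H.sv))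
    ((H.sa.mul (H.sk1.pow 2)).add (((SP.const 2).mul H.sk1).mul
      (H.sk2.add (H.sf.mul (H.sk.pow 2))))) ht
    (fun φ => ((H.sk1.hasT ht φ).fun_pow 2).fun_mul (H.sv.hasT ht φ))
    (fun φ => ((H.sa.hasP ht φ).fun_mul ((H.sk1.hasP ht φ).fun_pow 2)).fun_add
      (((H.sk1.hasP ht φ).const_mul 2).fun_mul ((H.sk2.hasP ht φ).fun_add
        ((H.sf.hasP ht φ).fun_mul ((H.sk.hasP ht φ).fun_pow 2))))) (fun φ => ?_)
  rw [H.vt ht, H.kp t ht, H.k1p t ht, H.fp ht]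
  simp
  linear_combination (2 * k1 t φ) * H.k1t ht φ

end GFlow

theorem twopi_pos : (0:ℝ) < 2 * π := by positivity

theorem II_eq3 {h g1 g2 g3 w : ℝ → ℝ → ℝ} {c1 c2 c3 t : ℝ} (ht : 0 < t)
    (s1 : SP g1) (s2 : SP g2) (s3 : SP g3) (sw : SP w)
    (e : ∀ φ ∈ Icc (0:ℝ) (2 * π),
      h t φ = c1 * g1 t φ + c2 * g2 t φ + c3 * g3 t φ + dP w t φ) :
    II h t = c1 * II g1 t + c2 * II g2 t + c3 * II g3 t := by
  have h1 : II h t = ∫ φ in (0:ℝ)..(2 * π),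
      (c1 * g1 t φ + c2 * g2 t φ + c3 * g3 t φ + dP w t φ) := by
    refine intervalIntegral.integral_congr fun φ hφ => e φ ?_
    rwa [uIcc_of_le twopi_pos.le] at hφ
  have i1 := (s1.ii ht 0 (2 * π)).const_mul c1
  have i2 := (s2.ii ht 0 (2 * π)).const_mul c2
  have i3 := (s3.ii ht 0 (2 * π)).const_mul c3
  rw [h1, intervalIntegral.integral_add ((i1.add i2).add i3) (sw.dp.ii ht _ _), sw.int_dP ht,
    intervalIntegral.integral_add (i1.add i2) i3, intervalIntegral.integral_add i1 i2]
  simp [II]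

theorem II_le3 {h g1 g2 g3 w : ℝ → ℝ → ℝ} {c1 c2 c3 t : ℝ} (ht : 0 < t) (sh : SP h)
    (s1 : SP g1) (s2 : SP g2) (s3 : SP g3) (sw : SP w)
    (e : ∀ φ ∈ Icc (0:ℝ) (2 * π),
      h t φ ≤ c1 * g1 t φ + c2 * g2 t φ + c3 * g3 t φ + dP w t φ) :
    II h t ≤ c1 * II g1 t + c2 * II g2 t + c3 * II g3 t := by
  have sr := ((((SP.const c1).mul s1).add ((SP.const c2).mul s2)).add
    ((SP.const c3).mul s3)).add sw.dp
  rw [← II_eq3 (h := fun t φ => c1 * g1 t φ + c2 * g2 t φ + c3 * g3 t φ + dP w t φ)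
    ht s1 s2 s3 sw (fun φ _ => rfl)]
  exact intervalIntegral.integral_mono_on twopi_pos.le (sh.ii ht _ _) (sr.ii ht _ _) e

theorem osc {u u' g : ℝ → ℝ} (hu : ∀ φ, HasDerivAt u (u' φ) φ) (cu : Continuous u')
    (cg : Continuous g) (h : ∀ φ, |u' φ| ≤ g φ) {a b : ℝ} (ha : a ∈ Icc (0:ℝ) (2 * π))
    (hb : b ∈ Icc (0:ℝ) (2 * π)) : |u b - u a| ≤ ∫ φ in (0:ℝ)..(2 * π), g φ := by
  have g0 : ∀ φ, 0 ≤ g φ := fun φ => (abs_nonneg _).trans (h φ)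
  rw [← intervalIntegral.integral_eq_sub_of_hasDerivAt (fun x _ => hu x)
    (cu.intervalIntegrable _ _)]
  have h1 := intervalIntegral.norm_integral_le_abs_of_norm_le (f := u') (g := g) (a := a) (b := b)
    (μ := volume) (ae_of_all _ fun φ => h φ) (cg.intervalIntegrable _ _)
  refine h1.trans ?_
  have hsub : uIoc a b ⊆ uIoc (0:ℝ) (2 * π) := by
    rw [uIoc_of_le twopi_pos.le]
    exact Ioc_subset_Ioc (le_min ha.1 hb.1) (max_le ha.2 hb.2)
  refine (intervalIntegral.abs_integral_mono_interval hsub (ae_of_all _ g0)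
    (cg.intervalIntegrable _ _)).trans_eq ?_
  exact abs_of_nonneg (intervalIntegral.integral_nonneg twopi_pos.le fun φ _ => g0 φ)

namespace GFlow

variable {x y p q v k k1 k2 a f : ℝ → ℝ → ℝ}

theorem Lpos (H : GFlow x y p q v k k1 k2 a f) {t : ℝ} (ht : 0 < t) : 0 < II v t :=
  intervalIntegral.intervalIntegral_pos_of_pos_on (H.sv.ii ht _ _) (fun φ _ => H.vpos t ht φ)
    twopi_pos

theorem quant (H : GFlow x y p q v k k1 k2 a f) {t : ℝ} (ht : 0 < t) :
    ∃ n : ℤ, II (fun t φ => k t φ * v t φ) t = n * (2 * π) := by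
  set Θ : ℝ → ℝ := fun φ => ∫ s in (0:ℝ)..φ, k t s * v t s with hΘ
  have hc : Continuous (fun s => k t s * v t s) := (H.sk.mul H.sv).cont ht
  have hΘd : ∀ φ, HasDerivAt Θ (k t φ * v t φ) φ := fun φ =>
    intervalIntegral.integral_hasDerivAt_right (hc.intervalIntegrable _ _)
      hc.stronglyMeasurable.stronglyMeasurableAtFilter hc.continuousAt
  have h1 : ∀ φ, HasDerivAt (fun φ => p t φ * cos (Θ φ) + q t φ * sin (Θ φ)) 0 φ := fun φ => by
    have := ((H.sp.hasP ht φ).fun_mul (hΘd φ).cos).fun_add ((H.sq.hasP ht φ).fun_mul (hΘd φ).sin)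
    refine this.congr_deriv ?_
    rw [H.pp t ht, H.qp t ht]; ring
  have h2 : ∀ φ, HasDerivAt (fun φ => q t φ * cos (Θ φ) - p t φ * sin (Θ φ)) 0 φ := fun φ => by
    have := ((H.sq.hasP ht φ).fun_mul (hΘd φ).cos).fun_sub ((H.sp.hasP ht φ).fun_mul (hΘd φ).sin)
    refine this.congr_deriv ?_
    rw [H.pp t ht, H.qp t ht]; ring
  have e1 := is_const_of_deriv_eq_zero (fun φ => (h1 φ).differentiableAt) (fun φ => (h1 φ).deriv)
    (2 * π) 0
  have e2 := is_const_of_deriv_eq_zero (fun φ => (h2 φ).differentiableAt) (fun φ => (h2 φ).deriv)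
    (2 * π) 0
  have hΘ0 : Θ 0 = 0 := by simp [hΘ]
  have p0 := H.sp.per t ht 0
  have q0 := H.sq.per t ht 0
  rw [zero_add] at p0 q0
  simp only [hΘ0, p0, q0, cos_zero, sin_zero] at e1 e2
  have u := H.unit t ht 0
  have hcos : cos (Θ (2 * π)) = 1 := by
    linear_combination (p t 0) * e1 + (q t 0) * e2 + (1 - cos (Θ (2 * π))) * u
  obtain ⟨n, hn⟩ := (cos_eq_one_iff _).1 hcos
  exact ⟨n, hn.symm⟩

theorem sz (t₀ : ℝ) : SP (fun _ _ => t₀) := SP.const t₀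

/-- bound for the normal component of the position relative to the base point. -/
theorem aN_bound (H : GFlow x y p q v k k1 k2 a f) {t : ℝ} (ht : 0 < t) {φ : ℝ}
    (hφ : φ ∈ Icc (0:ℝ) (2 * π)) :
    |-(x t φ - x t 0) * q t φ + (y t φ - y t 0) * p t φ| ≤ 2 * II v t := by
  have h0 : (0:ℝ) ∈ Icc (0:ℝ) (2 * π) := ⟨le_rfl, twopi_pos.le⟩
  have pq : ∀ φ, |p t φ| ≤ 1 ∧ |q t φ| ≤ 1 := fun φ => by
    have u := H.unit t ht φ
    constructor
    · rw [← sq_le_one_iff_abs_le_one]; nlinarith [sq_nonneg (q t φ)]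
    · rw [← sq_le_one_iff_abs_le_one]; nlinarith [sq_nonneg (p t φ)]
  have hx : |x t φ - x t 0| ≤ II v t := by
    refine osc (fun φ => H.sx.hasP ht φ) (H.sx.dp.cont ht) (H.sv.cont ht) (fun φ => ?_) h0 hφ
    rw [H.xp t ht, abs_mul, abs_of_pos (H.vpos t ht φ)]
    exact mul_le_of_le_one_right (H.vpos t ht φ).le (pq φ).1
  have hy : |y t φ - y t 0| ≤ II v t := by
    refine osc (fun φ => H.sy.hasP ht φ) (H.sy.dp.cont ht) (H.sv.cont ht) (fun φ => ?_) h0 hφ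
    rw [H.yp t ht, abs_mul, abs_of_pos (H.vpos t ht φ)]
    exact mul_le_of_le_one_right (H.vpos t ht φ).le (pq φ).2
  have b1 : |-(x t φ - x t 0) * q t φ| ≤ II v t := by
    rw [abs_mul, abs_neg]
    exact (mul_le_of_le_one_right (abs_nonneg _) (pq φ).2).trans hx
  have b2 : |(y t φ - y t 0) * p t φ| ≤ II v t := by
    rw [abs_mul]
    exact (mul_le_of_le_one_right (abs_nonneg _) (pq φ).1).trans hy
  exact (abs_add_le _ _).trans (by linarith)

theorem support_ineq (H : GFlow x y p q v k k1 k2 a f) {t : ℝ} (ht : 0 < t) (c : ℝ) :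
    II v t ≤ 2 * II v t ^ 2 * II (fun t φ => (k t φ - c) ^ 2 * v t φ) t
      + 1 / 2 * II v t + c * II (fun t φ => x t φ * dP y t φ - y t φ * dP x t φ) t := by
  have sw : SP (fun s φ => (x s φ - x t 0) * p s φ + (y s φ - y t 0) * q s φ
      + c * (y t 0 * x s φ - x t 0 * y s φ)) :=
    (((H.sx.sub (SP.const (x t 0))).mul H.sp).add ((H.sy.sub (SP.const (y t 0))).mul H.sq)).add
      ((SP.const c).mul (((SP.const (y t 0)).mul H.sx).sub ((SP.const (x t 0)).mul H.sy)))
  refine II_le3 ht H.sv (((H.sk.sub (SP.const c)).pow 2).mul H.sv) H.sv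
    ((H.sx.mul H.sy.dp).sub (H.sy.mul H.sx.dp)) sw fun φ hφ => ?_
  have hw : dP (fun s φ => (x s φ - x t 0) * p s φ + (y s φ - y t 0) * q s φ
      + c * (y t 0 * x s φ - x t 0 * y s φ)) t φ = _ :=
    (((((H.sx.hasP ht φ).sub_const (x t 0)).fun_mul (H.sp.hasP ht φ)).fun_add
      (((H.sy.hasP ht φ).sub_const (y t 0)).fun_mul (H.sq.hasP ht φ))).fun_add
      ((((H.sx.hasP ht φ).const_mul (y t 0)).fun_sub
        ((H.sy.hasP ht φ).const_mul (x t 0))).const_mul c)).deriv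
  rw [hw, H.xp t ht, H.yp t ht, H.pp t ht, H.qp t ht]
  have hv := H.vpos t ht φ
  have u := H.unit t ht φ
  have hb := H.aN_bound ht hφ
  set N := -(x t φ - x t 0) * q t φ + (y t φ - y t 0) * p t φ with hN
  have hb2 : N ^ 2 ≤ 4 * II v t ^ 2 := by
    have := sq_le_sq' (abs_le.1 hb).1 (abs_le.1 hb).2
    linarith
  have key : -(k t φ - c) * N ≤ 2 * II v t ^ 2 * (k t φ - c) ^ 2 + 1 / 2 := by
    nlinarith [sq_nonneg ((k t φ - c) * N + 1), mul_le_mul_of_nonneg_left hb2 (sq_nonneg (k t φ - c))]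
  have key2 := mul_le_mul_of_nonneg_right key hv.le
  have e : v t φ = -(k t φ - c) * N * v t φ +
    (c * (x t φ * (v t φ * q t φ) - y t φ * (v t φ * p t φ)) +
      (v t φ * p t φ * p t φ + (x t φ - x t 0) * -(k t φ * v t φ * q t φ) +
          (v t φ * q t φ * q t φ + (y t φ - y t 0) * (k t φ * v t φ * p t φ)) +
        c * (y t 0 * (v t φ * p t φ) - x t 0 * (v t φ * q t φ)))) := by
    rw [hN]; linear_combination (-v t φ) * u
  nlinarith [key2, e]

theorem area_le (H : GFlow x y p q v k k1 k2 a f) {t : ℝ} (ht : 0 < t) :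
    II (fun t φ => x t φ * dP y t φ - y t φ * dP x t φ) t ≤ 2 * II v t ^ 2 := by
  have := II_le3 (c1 := 2 * II v t) (c2 := 0) (c3 := 0) ht
    ((H.sx.mul H.sy.dp).sub (H.sy.mul H.sx.dp)) H.sv (SP.const 0) (SP.const 0)
    (w := fun s φ => x t 0 * y s φ - y t 0 * x s φ)
    (((SP.const (x t 0)).mul H.sy).sub ((SP.const (y t 0)).mul H.sx)) fun φ hφ => ?_
  · linarith
  have hw : dP (fun s φ => x t 0 * y s φ - y t 0 * x s φ) t φ = _ :=
    (((H.sy.hasP ht φ).const_mul (x t 0)).fun_sub ((H.sx.hasP ht φ).const_mul (y t 0))).deriv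
  rw [hw, H.xp t ht, H.yp t ht]
  have hb := (abs_le.1 (H.aN_bound ht hφ)).1
  have := mul_le_mul_of_nonneg_right hb (H.vpos t ht φ).le
  linarith

theorem fv_zero (H : GFlow x y p q v k k1 k2 a f) {t : ℝ} (ht : 0 < t)
    (hm : II (fun t φ => k t φ * v t φ) t = 2 * π) : II (fun t φ => f t φ * v t φ) t = 0 := by
  rw [II_eq3 (c1 := 1) (c2 := - (2 * π / II v t)) (c3 := 0) (w := fun _ _ => 0) ht
    (H.sk.mul H.sv) H.sv (SP.const 0) (SP.const 0) (fun φ _ => by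
      rw [H.feq t ht]; simp [dP]; ring), hm]
  have := (H.Lpos ht).ne'
  field_simp
  ring

theorem sup_bound (H : GFlow x y p q v k k1 k2 a f) {t : ℝ} (ht : 0 < t)
    (hm : II (fun t φ => k t φ * v t φ) t = 2 * π) {c : ℝ} (hc : 0 < c) {φ : ℝ}
    (hφ : φ ∈ Icc (0:ℝ) (2 * π)) :
    f t φ ^ 2 ≤ c * II (fun t φ => f t φ ^ 2 * v t φ) t
      + c⁻¹ * II (fun t φ => k1 t φ ^ 2 * v t φ) t := by
  have hz := H.fv_zero ht hm
  have cfv : Continuous (fun s => f t s * v t s) := (H.sf.mul H.sv).cont ht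
  have hd : ∀ φ, HasDerivAt (fun φ => ∫ s in (0:ℝ)..φ, f t s * v t s) (f t φ * v t φ) φ := fun φ =>
    intervalIntegral.integral_hasDerivAt_right (cfv.intervalIntegrable _ _)
      cfv.stronglyMeasurable.stronglyMeasurableAtFilter cfv.continuousAt
  obtain ⟨φ0, h0, hf0⟩ := exists_hasDerivAt_eq_zero twopi_pos
    (fun φ _ => (hd φ).continuousAt.continuousWithinAt)
    (by rw [intervalIntegral.integral_same]; exact hz.symm) (fun φ _ => hd φ)
  have hf00 : f t φ0 = 0 := by
    rcases mul_eq_zero.1 hf0 with h | h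
    · exact h
    · exact absurd h (H.vpos t ht φ0).ne'
  have ho := osc (u := fun φ => f t φ ^ 2) (u' := fun φ => 2 * f t φ * (k1 t φ * v t φ))
    (g := fun φ => c * (f t φ ^ 2 * v t φ) + c⁻¹ * (k1 t φ ^ 2 * v t φ))
    (fun φ => by
      have := (H.sf.hasP ht φ).fun_pow 2
      rw [H.fp ht] at this
      simpa using this)
    (((SP.const 2).mul H.sf).mul (H.sk1.mul H.sv) |>.cont ht)
    (((SP.const c).mul ((H.sf.pow 2).mul H.sv)).add
      ((SP.const c⁻¹).mul ((H.sk1.pow 2).mul H.sv)) |>.cont ht)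
    (fun φ => by
      have hv := H.vpos t ht φ
      have h1 : |2 * f t φ * k1 t φ| ≤ c * f t φ ^ 2 + c⁻¹ * k1 t φ ^ 2 := by
        have e1 : 0 ≤ c⁻¹ * (c * f t φ - k1 t φ) ^ 2 := by positivity
        have e2 : 0 ≤ c⁻¹ * (c * f t φ + k1 t φ) ^ 2 := by positivity
        have e3 : c⁻¹ * (c * f t φ - k1 t φ) ^ 2
            = c * f t φ ^ 2 + c⁻¹ * k1 t φ ^ 2 - 2 * f t φ * k1 t φ := by field_simp; ring
        have e4 : c⁻¹ * (c * f t φ + k1 t φ) ^ 2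
            = c * f t φ ^ 2 + c⁻¹ * k1 t φ ^ 2 + 2 * f t φ * k1 t φ := by field_simp; ring
        rw [abs_le]; constructor <;> linarith
      have h2 := mul_le_mul_of_nonneg_right h1 hv.le
      have h3 : |2 * f t φ * (k1 t φ * v t φ)| = |2 * f t φ * k1 t φ| * v t φ := by
        rw [← mul_assoc, abs_mul _ (v t φ), abs_of_pos hv]
      rw [h3]; linarith)
    (Ioo_subset_Icc_self h0) hφ
  have hE := II_eq3 (h := fun t φ => c * (f t φ ^ 2 * v t φ) + c⁻¹ * (k1 t φ ^ 2 * v t φ))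
    (c1 := c) (c2 := c⁻¹) (c3 := 0) (w := fun _ _ => 0) ht
    ((H.sf.pow 2).mul H.sv) ((H.sk1.pow 2).mul H.sv) (SP.const 0) (SP.const 0)
    (fun φ _ => by simp [dP])
  have := le_of_abs_le ho
  simp only [hf00] at this
  unfold II at hE ⊢
  linarith

end GFlow

namespace GFlow

variable {x y p q v k k1 k2 a f : ℝ → ℝ → ℝ}

theorem II_nonneg {g : ℝ → ℝ → ℝ} {t : ℝ} (h : ∀ φ, 0 ≤ g t φ) : 0 ≤ II g t :=
  intervalIntegral.integral_nonneg twopi_pos.le fun φ _ => h φ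

theorem hasL2 (H : GFlow x y p q v k k1 k2 a f) {t : ℝ} (ht : 0 < t) :
    HasDerivAt (II v) (-(II (fun t φ => k t φ ^ 2 * v t φ) t
      - 2 * π / II v t * II (fun t φ => k t φ * v t φ) t)) t := by
  refine (H.hasL ht).congr_deriv ?_
  rw [II_eq3 (c1 := -1) (c2 := 2 * π / II v t) (c3 := 0) (w := fun _ _ => 0) ht
    ((H.sk.pow 2).mul H.sv) (H.sk.mul H.sv) (SP.const 0) (SP.const 0) (fun φ _ => by
      rw [H.feq t ht]; simp [dP]; ring)]
  ring

theorem var_eq (H : GFlow x y p q v k k1 k2 a f) {t : ℝ} (ht : 0 < t) (c : ℝ) :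
    II (fun t φ => (k t φ - c) ^ 2 * v t φ) t = II (fun t φ => k t φ ^ 2 * v t φ) t
      - 2 * c * II (fun t φ => k t φ * v t φ) t + c ^ 2 * II v t := by
  rw [II_eq3 (c1 := 1) (c2 := -2 * c) (c3 := c ^ 2) (w := fun _ _ => 0) ht
    ((H.sk.pow 2).mul H.sv) (H.sk.mul H.sv) H.sv (SP.const 0) (fun φ _ => by
      simp [dP]; ring)]
  ring

theorem E_var (H : GFlow x y p q v k k1 k2 a f) {t : ℝ} (ht : 0 < t) :
    II (fun t φ => f t φ ^ 2 * v t φ) t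
      = II (fun s φ => (k s φ - 2 * π / II v t) ^ 2 * v s φ) t := by
  unfold II
  congr 1
  funext φ
  show f t φ ^ 2 * v t φ = (k t φ - 2 * π / II v t) ^ 2 * v t φ
  rw [H.feq t ht]

theorem E_eq (H : GFlow x y p q v k k1 k2 a f) {t : ℝ} (ht : 0 < t)
    (hm : II (fun t φ => k t φ * v t φ) t = 2 * π) :
    II (fun t φ => f t φ ^ 2 * v t φ) t
      = II (fun t φ => k t φ ^ 2 * v t φ) t - 4 * π ^ 2 / II v t := by
  rw [H.E_var ht, H.var_eq ht, hm]
  have := (H.Lpos ht).ne'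
  field_simp
  ring

theorem hasL3 (H : GFlow x y p q v k k1 k2 a f) {t : ℝ} (ht : 0 < t)
    (hm : II (fun t φ => k t φ * v t φ) t = 2 * π) :
    HasDerivAt (II v) (-(II (fun t φ => f t φ ^ 2 * v t φ) t)) t := by
  refine (H.hasL2 ht).congr_deriv ?_
  rw [H.E_eq ht hm, hm]; ring

theorem hasE (H : GFlow x y p q v k k1 k2 a f) {t : ℝ} (ht : 0 < t)
    (hm : ∀ t, 1 ≤ t → II (fun t φ => k t φ * v t φ) t = 2 * π) (h1 : 1 < t) :
    ∃ E', HasDerivAt (II (fun t φ => f t φ ^ 2 * v t φ)) E' t ∧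
      ∀ M, (∀ φ ∈ Icc (0:ℝ) (2 * π), f t φ ^ 2 ≤ M) →
      E' ≤ -2 * II (fun t φ => k1 t φ ^ 2 * v t φ) t
        + (9 / 2 * (2 * π / II v t) ^ 2 + 5 / 2 * M) * II (fun t φ => f t φ ^ 2 * v t φ) t := by
  have hL := H.Lpos ht
  have hd := (H.hasQ ht).fun_sub ((H.hasL3 ht (hm t h1.le)).fun_inv hL.ne' |>.const_mul (4 * π ^ 2))
  refine ⟨_, hd.congr_of_eventuallyEq ?_, fun M hM => ?_⟩
  · filter_upwards [Ioi_mem_nhds h1] with s hs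
    have hs' : 0 < s := lt_trans one_pos hs
    rw [H.E_eq hs' (hm s (le_of_lt hs)), div_eq_mul_inv]
  · have hE0 : 0 ≤ II (fun t φ => f t φ ^ 2 * v t φ) t := II_nonneg fun φ =>
      mul_nonneg (sq_nonneg _) (H.vpos t ht φ).le
    have hle : II (fun t φ => -2 * (k1 t φ ^ 2 * v t φ) + f t φ * k t φ ^ 3 * v t φ) t
        ≤ -2 * II (fun t φ => k1 t φ ^ 2 * v t φ) t
        + (9 / 2 * (2 * π / II v t) ^ 2 + 5 / 2 * M) * II (fun t φ => f t φ ^ 2 * v t φ) t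
        + (2 * π / II v t) ^ 3 * II (fun t φ => f t φ * v t φ) t := by
      refine II_le3 (w := fun _ _ => 0) ht
        (((SP.const (-2)).mul ((H.sk1.pow 2).mul H.sv)).add ((H.sf.mul (H.sk.pow 3)).mul H.sv))
        ((H.sk1.pow 2).mul H.sv) ((H.sf.pow 2).mul H.sv) (H.sf.mul H.sv) (SP.const 0)
        fun φ hφ => ?_
      have hk : k t φ = f t φ + 2 * π / II v t := by rw [H.feq t ht]; ring
      rw [hk]
      set l := 2 * π / II v t
      set F := f t φ
      have hv := H.vpos t ht φ
      have hz : dP (fun _ _ => (0:ℝ)) t φ = 0 := by simp [dP]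
      rw [hz]
      have hMF : F ^ 2 * F ^ 2 ≤ M * F ^ 2 := mul_le_mul_of_nonneg_right (hM φ hφ) (sq_nonneg _)
      have key : F * (F + l) ^ 3 ≤ (9 / 2 * l ^ 2 + 5 / 2 * M) * F ^ 2 + l ^ 3 * F := by
        nlinarith [sq_nonneg (F * (l - F))]
      have := mul_le_mul_of_nonneg_right key hv.le
      linarith
    rw [H.fv_zero ht (hm t h1.le)] at hle
    have hneg : 4 * π ^ 2 * (-(-(II (fun t φ => f t φ ^ 2 * v t φ) t)) / II v t ^ 2) ≥ 0 := by
      rw [neg_neg]; positivity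
    linarith

theorem hasD_le (H : GFlow x y p q v k k1 k2 a f) {t : ℝ} (ht : 0 < t) {M : ℝ}
    (hM : ∀ φ ∈ Icc (0:ℝ) (2 * π), f t φ ^ 2 ≤ M) :
      (II (fun t φ => -2 * (k2 t φ ^ 2 * v t φ) - 2 * (k2 t φ * f t φ * k t φ ^ 2 * v t φ)
        + f t φ * k t φ * k1 t φ ^ 2 * v t φ) t) ≤
      (8 * (2 * π / II v t) ^ 4 + 8 * M ^ 2) * II (fun t φ => f t φ ^ 2 * v t φ) t
        + ((2 * π / II v t) ^ 2 + 2 * M) * II (fun t φ => k1 t φ ^ 2 * v t φ) t := by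
  have := II_le3 (c1 := 8 * (2 * π / II v t) ^ 4 + 8 * M ^ 2)
    (c2 := (2 * π / II v t) ^ 2 + 2 * M) (c3 := 0) (w := fun _ _ => 0) ht
    ((((SP.const (-2)).mul ((H.sk2.pow 2).mul H.sv)).sub
      ((SP.const 2).mul (((H.sk2.mul H.sf).mul (H.sk.pow 2)).mul H.sv))).add
      (((H.sf.mul H.sk).mul (H.sk1.pow 2)).mul H.sv))
    ((H.sf.pow 2).mul H.sv) ((H.sk1.pow 2).mul H.sv) (SP.const 0) (SP.const 0) fun φ hφ => ?_
  · linarith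
  have hk : k t φ = f t φ + 2 * π / II v t := by rw [H.feq t ht]; ring
  have hz : dP (fun _ _ => (0:ℝ)) t φ = 0 := by simp [dP]
  rw [hz]
  have hF := hM φ hφ
  have hv := H.vpos t ht φ
  set K := k t φ
  set l := 2 * π / II v t
  set F := f t φ
  have M0 : 0 ≤ M := (sq_nonneg _).trans hF
  have e1 : K ^ 2 ≤ 2 * l ^ 2 + 2 * M := by rw [hk]; nlinarith [sq_nonneg (F - l)]
  have e2 : K ^ 4 ≤ 8 * l ^ 4 + 8 * M ^ 2 := by
    have : K ^ 2 * K ^ 2 ≤ (2 * l ^ 2 + 2 * M) * (2 * l ^ 2 + 2 * M) :=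
      mul_le_mul e1 e1 (sq_nonneg _) (by positivity)
    nlinarith [sq_nonneg (l ^ 2 - M)]
  have e3 : F * K ≤ l ^ 2 + 2 * M := by rw [hk]; nlinarith [sq_nonneg (F - l)]
  have e4 : -2 * k2 t φ ^ 2 - 2 * (k2 t φ * F * K ^ 2) ≤ (8 * l ^ 4 + 8 * M ^ 2) * F ^ 2 := by
    have := mul_le_mul_of_nonneg_right e2 (sq_nonneg F)
    nlinarith [sq_nonneg (k2 t φ + F * K ^ 2), sq_nonneg (k2 t φ)]
  have e5 := mul_le_mul_of_nonneg_right e3 (sq_nonneg (k1 t φ))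
  have := mul_le_mul_of_nonneg_right (add_le_add e4 e5) hv.le
  linarith

theorem const_of_zero {P : ℝ → ℝ} (h : ∀ t, 1 ≤ t → HasDerivAt P 0 t) {t : ℝ} (ht : 1 ≤ t) :
    P t = P 1 := by
  have h1 := anti_of_deriv (P' := fun _ => 0) h (fun _ _ => le_rfl)
  have h2 := anti_of_deriv (P := fun t => - P t) (P' := fun _ => -0) (fun t ht => (h t ht).fun_neg)
    (fun _ _ => by simp)
  have := h1 (mem_Ici.2 le_rfl) (mem_Ici.2 ht) ht
  have := h2 (mem_Ici.2 le_rfl) (mem_Ici.2 ht) ht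
  simp only at this
  linarith

theorem not_shrinking (H : GFlow x y p q v k k1 k2 a f) {L' : ℝ → ℝ}
    (hL : ∀ t, 1 ≤ t → HasDerivAt (II v) (L' t) t)
    (h : ∀ t, 1 ≤ t → II v t * L' t ≤ - (1 / 4)) : False := by
  refine no_linear_decay (P := fun t => II v t ^ 2) (P' := fun t => 2 * (II v t * L' t))
    (a := 1) (c := 1 / 2) (by norm_num) (fun t ht => ?_) (fun t ht => sq_nonneg _)
    (fun t ht => by linarith [h t ht])
  have := (hL t ht).fun_pow 2
  refine this.congr_deriv ?_
  simp; ring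

theorem total (H : GFlow x y p q v k k1 k2 a f) {t : ℝ} (ht : 1 ≤ t) :
    II (fun t φ => k t φ * v t φ) t = 2 * π := by
  obtain ⟨n, hn⟩ := H.quant one_pos
  have hc : ∀ t, 1 ≤ t → II (fun t φ => k t φ * v t φ) t = n * (2 * π) := fun t ht => by
    rw [← hn]
    exact const_of_zero (fun t ht => H.hasK (one_pos.trans_le ht)) ht
  have hn1 : n = 1 := by
    by_contra hne
    refine H.not_shrinking (fun t ht => H.hasL2 (one_pos.trans_le ht)) (fun t ht => ?_)
    have ht0 : 0 < t := one_pos.trans_le ht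
    have hL := H.Lpos ht0
    rw [hc t ht]
    set L := II v t with hLdef
    have e1 : L * -(II (fun t φ => k t φ ^ 2 * v t φ) t - 2 * π / L * (n * (2 * π)))
        = - (L * II (fun t φ => k t φ ^ 2 * v t φ) t) + 4 * π ^ 2 * n := by
      field_simp; ring
    rw [e1]
    by_cases h0 : n = 0
    · have := H.support_ineq ht0 0
      simp only [sub_zero, zero_mul, add_zero] at this
      rw [← hLdef] at this
      have h2 : L * (1 / 2) ≤ L * (2 * L * II (fun t φ => k t φ ^ 2 * v t φ) t) := by
        nlinarith
      have h3 := le_of_mul_le_mul_left h2 hL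
      rw [h0]; push_cast; linarith
    · have hv := H.var_eq ht0 (2 * π * n / L)
      have hnn : 0 ≤ II (fun s φ => (k s φ - 2 * π * n / L) ^ 2 * v s φ) t := II_nonneg fun φ =>
        mul_nonneg (sq_nonneg _) (H.vpos t ht0 φ).le
      rw [hv, hc t ht, ← hLdef] at hnn
      have h2 := mul_nonneg hL.le hnn
      have h3 : L * (II (fun t φ => k t φ ^ 2 * v t φ) t - 2 * (2 * π * n / L) * (n * (2 * π))
          + (2 * π * n / L) ^ 2 * L)
          = L * II (fun t φ => k t φ ^ 2 * v t φ) t - 4 * π ^ 2 * n ^ 2 := by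
        field_simp; ring
      rw [h3] at h2
      have hint : (n:ℤ) + 1 ≤ n ^ 2 := by
        rcases lt_or_gt_of_ne h0 with h | h
        · nlinarith
        · have : 2 ≤ n := by omega
          nlinarith
      have hint2 : (n:ℝ) + 1 ≤ (n:ℝ) ^ 2 := by exact_mod_cast hint
      have hpi : (1:ℝ) ≤ π ^ 2 := by nlinarith [pi_gt_three]
      nlinarith
  rw [hc t ht, hn1]; simp

theorem main (H : GFlow x y p q v k k1 k2 a f) :
    Tendsto (II (fun t φ => k1 t φ ^ 2 * v t φ)) atTop (nhds 0) := by
  have hm : ∀ t, 1 ≤ t → II (fun t φ => k t φ * v t φ) t = 2 * π := fun t ht => H.total ht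
  have pos : ∀ {t : ℝ}, 1 ≤ t → 0 < t := fun h => one_pos.trans_le h
  set E := II (fun t φ => f t φ ^ 2 * v t φ) with hE
  set D := II (fun t φ => k1 t φ ^ 2 * v t φ) with hD
  set A := II (fun t φ => x t φ * dP y t φ - y t φ * dP x t φ) with hA
  have hE0 : ∀ t, 1 ≤ t → 0 ≤ E t := fun t ht => II_nonneg fun φ =>
      mul_nonneg (sq_nonneg _) (H.vpos t (pos ht) φ).le
  have hD0 : ∀ t, 1 ≤ t → 0 ≤ D t := fun t ht => II_nonneg fun φ =>
      mul_nonneg (sq_nonneg _) (H.vpos t (pos ht) φ).le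
  have hAc : ∀ t, 1 ≤ t → A t = A 1 := fun t ht => by
    refine const_of_zero (fun t ht => (H.hasA (pos ht)).congr_deriv ?_) ht
    rw [II_eq3 (c1 := -2) (c2 := 0) (c3 := 0) (w := fun _ _ => 0) (pos ht)
      (H.sf.mul H.sv) (SP.const 0) (SP.const 0) (SP.const 0) (fun φ _ => by simp [dP]),
      H.fv_zero (pos ht) (hm t ht)]
    simp
  have hLd : ∀ t, 1 ≤ t → HasDerivAt (II v) (- E t) t := fun t ht => H.hasL3 (pos ht) (hm t ht)
  have hApos : 0 < A 1 := by
    by_contra hneg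
    push Not at hneg
    refine H.not_shrinking hLd (fun t ht => ?_)
    have hL := H.Lpos (pos ht)
    have := H.support_ineq (pos ht) (2 * π / II v t)
    rw [← H.E_var (pos ht), ← hE, ← hA, hAc t ht] at this
    have h1 : 2 * π / II v t * A 1 ≤ 0 := mul_nonpos_of_nonneg_of_nonpos (by positivity) hneg
    have h2 : II v t * (1 / 2) ≤ II v t * (2 * II v t * E t) := by nlinarith
    have h3 := le_of_mul_le_mul_left h2 hL
    linarith
  -- upper bound for the square of `2π/L`
  obtain ⟨B, hB0, hB⟩ : ∃ B : ℝ, 0 ≤ B ∧ ∀ t, 1 ≤ t → (2 * π / II v t) ^ 2 ≤ B := by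
    refine ⟨8 * π ^ 2 / A 1, by positivity, fun t ht => ?_⟩
    have h1 := H.area_le (pos ht)
    rw [← hA, hAc t ht] at h1
    have hL := H.Lpos (pos ht)
    rw [div_pow, div_le_div_iff₀ (by positivity) hApos]
    nlinarith [sq_nonneg π]
  have hEd : ∀ t, 2 ≤ t → ∃ E', HasDerivAt E E' t ∧
      E' ≤ - D t + (9 / 2 * B + 12) * (E t + E t ^ 3) := fun t ht => by
    have ht1 : 1 ≤ t := by linarith
    obtain ⟨E', h1, h2⟩ := H.hasE (pos ht1) hm (by linarith)
    refine ⟨E', h1, ?_⟩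
    have e0 := hE0 t ht1
    have d0 := hD0 t ht1
    have hc : 0 < 3 * (1 + E t) := by positivity
    have h3 := h2 _ (fun φ hφ => H.sup_bound (pos ht1) (hm t ht1) hc hφ)
    rw [← hE, ← hD] at h3
    have h4 : (3 * (1 + E t))⁻¹ * E t ≤ 1 / 3 := by
      rw [inv_mul_le_iff₀ hc]; linarith
    have h5 := mul_le_mul_of_nonneg_right h4 d0
    have h6 := mul_le_mul_of_nonneg_right (hB t ht1) e0
    have h7 : 0 ≤ B * E t ^ 3 := by positivity
    have h8 : 0 ≤ E t * (E t - 1) ^ 2 := by positivity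
    nlinarith [pow_nonneg e0 3]
  choose! E' hE'1 hE'2 using hEd
  have hLp : ∀ t, 1 ≤ t → 0 ≤ II v t := fun t ht => (H.Lpos (pos ht)).le
  -- first step: `E` tends to zero
  have hEt : Tendsto E atTop (nhds 0) := by
    refine decay_lemma (a := 2) (C := 9 / 2 * B + 12) (by positivity) hE'1
      (fun t ht => hLd t (by linarith)) (fun t ht => hE0 t (by linarith))
      (fun t ht => hLp t (by linarith)) (fun t ht => le_rfl) (fun t ht => ?_)
    linarith [hE'2 t ht, hD0 t (by linarith)]
  -- second step
  obtain ⟨b, hb⟩ := eventually_atTop.1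
    ((hEt.eventually (gt_mem_nhds (show (0:ℝ) < 1 by norm_num))).and (eventually_ge_atTop 2))
  set C1 := 9 / 2 * B + 12 with hC1
  have hC10 : 0 ≤ C1 := by positivity
  have hG : Tendsto (fun t => E t + D t) atTop (nhds 0) := by
    refine decay_lemma (a := b) (C := C1 + 8 * B ^ 2 + B + 10) (by positivity)
      (P := fun t => E t + (2 * C1 + 1) * II v t)
      (fun t ht => (hE'1 t (hb t ht).2).fun_add
        (H.hasD (pos (by linarith [(hb t ht).2]))))
      (fun t ht => (hE'1 t (hb t ht).2).fun_add ((hLd t (by linarith [(hb t ht).2])).const_mul _))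
      (fun t ht => ?_) (fun t ht => ?_) (fun t ht => ?_) (fun t ht => ?_)
    all_goals
      have ht1 : 1 ≤ t := by linarith [(hb t ht).2]
      have e0 := hE0 t ht1
      have d0 := hD0 t ht1
      have l0 := hLp t ht1
      have e1 := (hb t ht).1
      have f1 := hE'2 t (hb t ht).2
    · positivity
    · positivity
    · have : E t ^ 3 ≤ E t := by
        have : E t ^ 2 ≤ 1 := by nlinarith
        nlinarith
      nlinarith [mul_le_mul_of_nonneg_left this hC10]
    · have hs : ∀ φ ∈ Icc (0:ℝ) (2 * π), f t φ ^ 2 ≤ E t + D t := fun φ hφ => by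
        have := H.sup_bound (pos ht1) (hm t ht1) one_pos hφ
        simpa using this
      have g1 := H.hasD_le (pos ht1) hs
      rw [← hE, ← hD] at g1
      have hb2 := hB t ht1
      have hb4 : (2 * π / II v t) ^ 4 ≤ B ^ 2 := by
        have := pow_le_pow_left₀ (sq_nonneg _) hb2 2
        calc _ = ((2 * π / II v t) ^ 2) ^ 2 := by ring
          _ ≤ _ := this
      have hEG : E t ≤ E t + D t := by linarith
      have hDG : D t ≤ E t + D t := by linarith
      set G := E t + D t with hGdef
      have g0 : 0 ≤ G := by positivity
      have g2 : (8 * (2 * π / II v t) ^ 4 + 8 * G ^ 2) * E t ≤ (8 * B ^ 2 + 8 * G ^ 2) * G :=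
        mul_le_mul (by linarith) hEG e0 (by positivity)
      have g3 : ((2 * π / II v t) ^ 2 + 2 * G) * D t ≤ (B + 2 * G) * G :=
        mul_le_mul (by linarith) hDG d0 (by positivity)
      have g4 : E t ^ 3 ≤ G ^ 3 := pow_le_pow_left₀ e0 hEG 3
      have g5 : C1 * (E t + E t ^ 3) ≤ C1 * (G + G ^ 3) :=
        mul_le_mul_of_nonneg_left (by linarith) hC10
      have g6 : 2 * G ^ 2 ≤ G + G ^ 3 := by nlinarith [mul_nonneg g0 (sq_nonneg (G - 1))]
      have g7 : 0 ≤ G ^ 3 := by positivity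
      have g8 : 0 ≤ B ^ 2 * G ^ 3 := by positivity
      have g9 : 0 ≤ B * G ^ 3 := by positivity
      nlinarith
  refine squeeze_zero' ?_ ?_ hG
  · filter_upwards [eventually_ge_atTop 1] with t ht using hD0 t ht
  · filter_upwards [eventually_ge_atTop 1] with t ht
    linarith [hE0 t ht]

end GFlow


theorem GFlow.ofCurve {x y v p q k k1 : ℝ → ℝ → ℝ} (hx : SP x) (hy : SP y)
    (h0 : ∀ t, 0 < t → ∀ φ, dP x t φ ^ 2 + dP y t φ ^ 2 ≠ 0)
    (hv : v = fun t φ => Real.sqrt (dP x t φ ^ 2 + dP y t φ ^ 2))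
    (hp : p = fun t φ => dP x t φ / v t φ)
    (hq : q = fun t φ => dP y t φ / v t φ)
    (hk : k = fun t φ => (dP x t φ * dP (dP y) t φ - dP y t φ * dP (dP x) t φ) / v t φ ^ 3)
    (hk1 : k1 = fun t φ => dP k t φ / v t φ)
    (hf : ∀ t, 0 < t → ∀ φ, dT y t φ * p t φ - dT x t φ * q t φ = k t φ - 2 * π / II v t) :
    GFlow x y p q v k k1 (fun t φ => dP k1 t φ / v t φ)
      (fun t φ => dT x t φ * p t φ + dT y t φ * q t φ)
      (fun t φ => dT y t φ * p t φ - dT x t φ * q t φ) := by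
  have sv : SP v := by
    rw [hv]; exact ((hx.dp.pow 2).add (hy.dp.pow 2)).sqrt h0
  have vpos : ∀ t, 0 < t → ∀ φ, 0 < v t φ := by
    intro t ht φ
    rw [hv]
    exact Real.sqrt_pos.2 (lt_of_le_of_ne (by positivity) (h0 t ht φ).symm)
  have vne : ∀ t, 0 < t → ∀ φ, v t φ ≠ 0 := fun t ht φ => (vpos t ht φ).ne'
  have vsq : ∀ t φ, v t φ ^ 2 = dP x t φ ^ 2 + dP y t φ ^ 2 := by
    intro t φ
    rw [hv]
    exact Real.sq_sqrt (by positivity)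
  have sp : SP p := by rw [hp]; exact hx.dp.div sv vne
  have sq : SP q := by rw [hq]; exact hy.dp.div sv vne
  have sk : SP k := by
    rw [hk]
    exact ((hx.dp.mul hy.dp.dp).sub (hy.dp.mul hx.dp.dp)).div (sv.pow 3)
      (fun t ht φ => pow_ne_zero 3 (vne t ht φ))
  have sk1 : SP k1 := by rw [hk1]; exact sk.dp.div sv vne
  have xp : ∀ t, 0 < t → ∀ φ, dP x t φ = v t φ * p t φ := by
    intro t ht φ
    rw [hp]; have := vne t ht φ; field_simp
  have yp : ∀ t, 0 < t → ∀ φ, dP y t φ = v t φ * q t φ := by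
    intro t ht φ
    rw [hq]; have := vne t ht φ; field_simp
  have un : ∀ t, 0 < t → ∀ φ, p t φ ^ 2 + q t φ ^ 2 = 1 := by
    intro t ht φ
    have h1 := vsq t φ
    rw [xp t ht φ, yp t ht φ] at h1
    have h2 := vne t ht φ
    have h3 : v t φ ^ 2 * (p t φ ^ 2 + q t φ ^ 2) = v t φ ^ 2 * 1 := by linarith
    exact mul_left_cancel₀ (pow_ne_zero 2 h2) h3
  have fr : ∀ t, 0 < t → ∀ φ, dP p t φ = - (k t φ * v t φ * q t φ) ∧
      dP q t φ = k t φ * v t φ * p t φ := by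
    intro t ht φ
    have d1 : dP (dP x) t φ = dP v t φ * p t φ + v t φ * dP p t φ :=
      SP.dP_eq (h := fun t φ => v t φ * p t φ) ((sv.hasP ht φ).fun_mul (sp.hasP ht φ)) (xp t ht)
    have d2 : dP (dP y) t φ = dP v t φ * q t φ + v t φ * dP q t φ :=
      SP.dP_eq (h := fun t φ => v t φ * q t φ) ((sv.hasP ht φ).fun_mul (sq.hasP ht φ)) (yp t ht)
    have d3 : p t φ * dP p t φ + q t φ * dP q t φ = 0 := by
      have e1 := ((sp.hasP ht φ).fun_pow 2).fun_add ((sq.hasP ht φ).fun_pow 2)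
      have e2 : (fun φ => p t φ ^ 2 + q t φ ^ 2) = fun _ => 1 := funext (un t ht)
      rw [e2] at e1
      have e3 := e1.unique (hasDerivAt_const φ (1 : ℝ))
      norm_num at e3
      linarith
    have d4 : k t φ * v t φ = p t φ * dP q t φ - q t φ * dP p t φ := by
      have h2 := vne t ht φ
      have e : k t φ = (dP x t φ * dP (dP y) t φ - dP y t φ * dP (dP x) t φ) / v t φ ^ 3 := by
        rw [hk]
      rw [e, d1, d2, xp t ht φ, yp t ht φ]
      field_simp
      ring
    have u := un t ht φ
    rw [d4]
    constructor
    · linear_combination (-dP p t φ) * u + p t φ * d3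
    · linear_combination (-dP q t φ) * u + q t φ * d3
  exact
  { sx := hx, sy := hy, sp := sp, sq := sq, sv := sv, sk := sk, sk1 := sk1
    sk2 := sk1.dp.div sv vne
    sa := (hx.dt.mul sp).add (hy.dt.mul sq)
    sf := (hy.dt.mul sp).sub (hx.dt.mul sq)
    vpos := vpos, xp := xp, yp := yp, unit := un
    pp := fun t ht φ => (fr t ht φ).1
    qp := fun t ht φ => (fr t ht φ).2
    kp := by
      intro t ht φ
      have h2 := vne t ht φ
      rw [hk1]; field_simp
    k1p := by
      intro t ht φ
      have h2 := vne t ht φ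
      field_simp
    xt := by
      intro t ht φ
      linear_combination (-dT x t φ) * un t ht φ
    yt := by
      intro t ht φ
      linear_combination (-dT y t φ) * un t ht φ
    feq := hf }

theorem fst_SP {X : ℝ → ℝ → ℝ × ℝ} {X₀ : ℝ → ℝ × ℝ} (hsol : IsGAPFSolutionOn X X₀ (Set.Ici 0)) :
    SP (fun t φ => (X t φ).1) where
  sm := (hsol.smooth.mono (prod_mono Ioi_subset_Ici_self le_rfl)).fst
  per := fun t ht φ => by
    have := (hsol.curve t (le_of_lt ht)).periodic φ
    rw [this]

theorem snd_SP {X : ℝ → ℝ → ℝ × ℝ} {X₀ : ℝ → ℝ × ℝ} (hsol : IsGAPFSolutionOn X X₀ (Set.Ici 0)) :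
    SP (fun t φ => (X t φ).2) where
  sm := (hsol.smooth.mono (prod_mono Ioi_subset_Ici_self le_rfl)).snd
  per := fun t ht φ => by
    have := (hsol.curve t (le_of_lt ht)).periodic φ
    rw [this]

theorem deriv_pair {Y : ℝ → ℝ × ℝ} {x y : ℝ → ℝ → ℝ} {t : ℝ} (ht : 0 < t) (hx : SP x) (hy : SP y)
    (h : ∀ φ, Y φ = (x t φ, y t φ)) (φ : ℝ) : deriv Y φ = (dP x t φ, dP y t φ) := by
  have e : Y = fun φ => (x t φ, y t φ) := funext h
  rw [e]
  exact ((hx.hasP ht φ).prodMk (hy.hasP ht φ)).deriv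

/-- Along a global solution of Gage's area-preserving flow, the `L²` norm of
`∂κ/∂s` tends to zero as `t → ∞`. -/
theorem gapf_L2_curvature_deriv_tendsto_zero
    (X : ℝ → ℝ → ℝ × ℝ) (X₀ : ℝ → ℝ × ℝ)
    (hX₀ : IsSmoothClosedCurve X₀) (hemb : IsEmbeddedCurve X₀)
    (hsol : IsGAPFSolutionOn X X₀ (Set.Ici 0)) :
    Filter.Tendsto (fun t => gapfCurvDerivIntegral X t) Filter.atTop (nhds 0) := by
  obtain ⟨α, hfl⟩ := hsol.flow
  have hx := fst_SP hsol
  have hy := snd_SP hsol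
  set x : ℝ → ℝ → ℝ := fun t φ => (X t φ).1 with hxd
  set y : ℝ → ℝ → ℝ := fun t φ => (X t φ).2 with hyd
  have D1 : ∀ t, 0 < t → ∀ φ, deriv (X t) φ = (dP x t φ, dP y t φ) := fun t ht φ =>
    deriv_pair ht hx hy (fun _ => rfl) φ
  have D2 : ∀ t, 0 < t → ∀ φ, deriv (deriv (X t)) φ = (dP (dP x) t φ, dP (dP y) t φ) :=
    fun t ht φ => deriv_pair ht hx.dp hy.dp (D1 t ht) φ
  have h0 : ∀ t, 0 < t → ∀ φ, dP x t φ ^ 2 + dP y t φ ^ 2 ≠ 0 := by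
    intro t ht φ h
    refine (hsol.curve t (le_of_lt ht)).regular φ ?_
    rw [D1 t ht φ]
    have h1 : dP x t φ = 0 := by nlinarith [sq_nonneg (dP x t φ), sq_nonneg (dP y t φ)]
    have h2 : dP y t φ = 0 := by nlinarith [sq_nonneg (dP x t φ), sq_nonneg (dP y t φ)]
    rw [h1, h2]; rfl
  obtain ⟨v, hv⟩ : ∃ v : ℝ → ℝ → ℝ, v = fun t φ => Real.sqrt (dP x t φ ^ 2 + dP y t φ ^ 2) :=
    ⟨_, rfl⟩
  obtain ⟨p, hp⟩ : ∃ p : ℝ → ℝ → ℝ, p = fun t φ => dP x t φ / v t φ := ⟨_, rfl⟩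
  obtain ⟨q, hq⟩ : ∃ q : ℝ → ℝ → ℝ, q = fun t φ => dP y t φ / v t φ := ⟨_, rfl⟩
  obtain ⟨k, hk⟩ : ∃ k : ℝ → ℝ → ℝ, k = fun t φ =>
    (dP x t φ * dP (dP y) t φ - dP y t φ * dP (dP x) t φ) / v t φ ^ 3 := ⟨_, rfl⟩
  obtain ⟨k1, hk1⟩ : ∃ k1 : ℝ → ℝ → ℝ, k1 = fun t φ => dP k t φ / v t φ := ⟨_, rfl⟩
  have V : ∀ t, 0 < t → ∀ φ, vnorm (deriv (X t) φ) = v t φ := by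
    intro t ht φ
    rw [D1 t ht φ, hv]; rfl
  have K : ∀ t, 0 < t → ∀ φ, curv (X t) φ = k t φ := by
    intro t ht φ
    rw [curv, V t ht φ, D1 t ht φ, D2 t ht φ, hk]; rfl
  have Len : ∀ t, 0 < t → clen (X t) = II v t := by
    intro t ht
    unfold clen II
    congr 1
    funext φ
    exact V t ht φ
  have T : ∀ t, 0 < t → ∀ φ, unitTangent (X t) φ = (p t φ, q t φ) := by
    intro t ht φ
    rw [unitTangent, V t ht φ, D1 t ht φ, hp, hq]
    ext
    · simp [div_eq_inv_mul]
    · simp [div_eq_inv_mul]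
  have un : ∀ t, 0 < t → ∀ φ, p t φ ^ 2 + q t φ ^ 2 = 1 := by
    intro t ht φ
    have hs : v t φ ^ 2 = dP x t φ ^ 2 + dP y t φ ^ 2 := by
      rw [hv]; exact Real.sq_sqrt (by positivity)
    rw [hp, hq]
    show (dP x t φ / v t φ) ^ 2 + (dP y t φ / v t φ) ^ 2 = 1
    rw [div_pow, div_pow, ← add_div, hs]
    exact div_self (h0 t ht φ)
  have hf : ∀ t, 0 < t → ∀ φ,
      dT y t φ * p t φ - dT x t φ * q t φ = k t φ - 2 * π / II v t := by
    intro t ht φ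
    have h1 := (hfl t (le_of_lt ht) φ).hasDerivAt (Ici_mem_nhds ht)
    rw [innerNormal, T t ht φ, K t ht φ, Len t ht] at h1
    have e1 : dT x t φ = _ := (HasFDerivAt.hasDerivAt (HasFDerivAt.fst h1.hasFDerivAt)).deriv
    have e2 : dT y t φ = _ := (HasFDerivAt.hasDerivAt (HasFDerivAt.snd h1.hasFDerivAt)).deriv
    rw [e1, e2]
    simp only [Prod.fst_add, Prod.snd_add, Prod.smul_fst, Prod.smul_snd, smul_eq_mul,
      ContinuousLinearMap.comp_apply, ContinuousLinearMap.toSpanSingleton_apply, one_smul,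
      ContinuousLinearMap.coe_fst', ContinuousLinearMap.coe_snd']
    linear_combination (k t φ - 2 * π / II v t) * un t ht φ
  have G := GFlow.ofCurve hx hy h0 hv hp hq hk hk1 hf
  refine G.main.congr' ?_
  filter_upwards [eventually_gt_atTop (0 : ℝ)] with t ht
  unfold II gapfCurvDerivIntegral
  congr 1
  funext φ
  have e : curv (X t) = k t := funext (K t ht)
  rw [V t ht φ, e, hk1]
  rfl
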